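/- arXiv:1711.06114 — 3 statements merged into one kernel-verified Lean document; each statement's English description precedes it below -/
import Mathlib

section
/- Let X be a measurable space, let D_S and D_T be probability measures on X, let h, g_S, g_T : X → [0,1] be measurable functions, and define the error ε_A(h,g) = ∫ |h − g| dD_A. Let F be a nonempty class of measurable functions X → ℝ, each integrable with respect to both D_S and D_T, such that the functions |h − g_S| and |h − g_T| belong to F and the set { |∫ f dD_S − ∫ f dD_T| : f ∈ F } is bounded above, and set d_F(D_S,D_T) = sup_{f∈F} |∫ f dD_S − ∫ f dD_T|. Then ε_T(h,g_T) ≤ ε_S(h,g_S) + d_F(D_S,D_T) + min{ ∫ |g_S − g_T| dD_S, ∫ |g_S − g_T| dD_T }. -/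
open MeasureTheory

/-- The `L¹` triangle inequality, with pointwise absolute values. -/
theorem integral_abs_sub_le_add {X : Type*} [MeasurableSpace X] {μ : Measure X} {f g k : X → ℝ}
    (hfg : Integrable (fun x => |f x - g x|) μ) (hfk : Integrable (fun x => |f x - k x|) μ)
    (hgk : Integrable (fun x => |g x - k x|) μ) :
    (∫ x, |f x - k x| ∂μ) ≤ (∫ x, |f x - g x| ∂μ) + ∫ x, |g x - k x| ∂μ := by
  rw [← integral_add hfg hgk]
  exact integral_mono hfk (hfg.add hgk) fun x => abs_sub_le (f x) (g x) (k x)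

/-- The distance of two measurable functions with values in `[0, 1]` is integrable. -/
theorem integrable_abs_sub_of_mem_Icc {X : Type*} [MeasurableSpace X] {μ : Measure X}
    [IsFiniteMeasure μ] {f g : X → ℝ} (hf : Measurable f) (hg : Measurable g)
    (hf01 : ∀ x, f x ∈ Set.Icc (0 : ℝ) 1) (hg01 : ∀ x, g x ∈ Set.Icc (0 : ℝ) 1) :
    Integrable (fun x => |f x - g x|) μ :=
  ((Integrable.of_mem_Icc 0 1 hf.aemeasurable (.of_forall hf01)).sub
    (Integrable.of_mem_Icc 0 1 hg.aemeasurable (.of_forall hg01))).abs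

/-- Ben-David et al. style target error bound via an integral probability metric. -/
theorem target_error_bound
    {X : Type*} [MeasurableSpace X]
    (DS DT : Measure X) [IsProbabilityMeasure DS] [IsProbabilityMeasure DT]
    (h gS gT : X → ℝ)
    (hh : Measurable h) (hgS : Measurable gS) (hgT : Measurable gT)
    (hh01 : ∀ x, h x ∈ Set.Icc (0 : ℝ) 1)
    (hgS01 : ∀ x, gS x ∈ Set.Icc (0 : ℝ) 1)
    (hgT01 : ∀ x, gT x ∈ Set.Icc (0 : ℝ) 1)
    (F : Set (X → ℝ)) (hFne : F.Nonempty)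
    (hFmeas : ∀ f ∈ F, Measurable f)
    (hFintS : ∀ f ∈ F, Integrable f DS)
    (hFintT : ∀ f ∈ F, Integrable f DT)
    (hmemS : (fun x => |h x - gS x|) ∈ F)
    (hmemT : (fun x => |h x - gT x|) ∈ F)
    (hbdd : BddAbove ((fun f : X → ℝ => |(∫ x, f x ∂DS) - ∫ x, f x ∂DT|) '' F)) :
    (∫ x, |h x - gT x| ∂DT) ≤
      (∫ x, |h x - gS x| ∂DS)
      + sSup ((fun f : X → ℝ => |(∫ x, f x ∂DS) - ∫ x, f x ∂DT|) '' F)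
      + min (∫ x, |gS x - gT x| ∂DS) (∫ x, |gS x - gT x| ∂DT) := by
  have le_sSup_of_mem : ∀ f ∈ F, (∫ x, f x ∂DT) - ∫ x, f x ∂DS ≤
      sSup ((fun f : X → ℝ => |(∫ x, f x ∂DS) - ∫ x, f x ∂DT|) '' F) := fun f hf =>
    (le_abs_self _).trans ((abs_sub_comm _ _).trans_le (le_csSup hbdd ⟨f, hf, rfl⟩))
  have hS := le_sSup_of_mem _ hmemS
  have hT := le_sSup_of_mem _ hmemT
  have triangleS := integral_abs_sub_le_add (hFintS _ hmemS) (hFintS _ hmemT)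
    (integrable_abs_sub_of_mem_Icc hgS hgT hgS01 hgT01)
  have triangleT := integral_abs_sub_le_add (hFintT _ hmemS) (hFintT _ hmemT)
    (integrable_abs_sub_of_mem_Icc hgS hgT hgS01 hgT01)
  rw [← sub_le_iff_le_add']
  apply le_min <;> linarith
end

section
/- Let a < b be real numbers, let D and D' be probability measures on ℝ supported on [a,b], and for j ≥ 2 let c_j(D) = E_D[(x − E_D[x])^j] denote the j-th central moment (and c_1(D) = E_D[x]). Then for every j ≥ 1, (1/|b−a|^j) · |c_j(D) − c_j(D')| ≤ 2 · ( (1/(j+1)) · (j/(j+1))^j + 1/2^{1+j} ). -/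
open MeasureTheory

/-- The `j`-th central moment of a probability measure on `ℝ`
(`c₁(D) = E_D[x]`, and `c_j(D) = E_D[(x − E_D[x])^j]` for `j ≥ 2`). -/
noncomputable def cMom (j : ℕ) (D : Measure ℝ) : ℝ :=
  if j = 1 then ∫ x, x ∂D else ∫ x, (x - ∫ y, y ∂D) ^ j ∂D

lemma succ_mul_pow_sub_mul_pow_succ_le_one {s : ℝ} (hs : 0 ≤ s) (j : ℕ) :
    ((j : ℝ) + 1) * s ^ j - j * s ^ (j + 1) ≤ 1 := by
  induction j with
  | zero => simp
  | succ j ih =>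
    have h : 0 ≤ (1 - s) * (1 - s ^ (j + 1)) := by
      rcases le_total s 1 with h1 | h1
      · exact mul_nonneg (by linarith) (by linarith [pow_le_one₀ (n := j + 1) hs h1])
      · exact mul_nonneg_of_nonpos_of_nonpos (by linarith)
          (by linarith [one_le_pow₀ (n := j + 1) h1])
    have ih' := mul_le_mul_of_nonneg_left ih hs
    push_cast
    ring_nf at h ih' ⊢
    linarith

lemma pow_mul_one_sub_le {q : ℝ} (hq : 0 ≤ q) {j : ℕ} (hj : 1 ≤ j) :
    q ^ j * (1 - q) ≤ 1 / ((j : ℝ) + 1) * ((j : ℝ) / (j + 1)) ^ j := by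
  have hj0 : (0 : ℝ) < j := by exact_mod_cast hj
  obtain ⟨s, hs, rfl⟩ : ∃ s : ℝ, 0 ≤ s ∧ q = (j : ℝ) / (j + 1) * s :=
    ⟨q * ((j + 1) / j), by positivity, by field_simp⟩
  have h := succ_mul_pow_sub_mul_pow_succ_le_one hs j
  calc ((j : ℝ) / (j + 1) * s) ^ j * (1 - (j : ℝ) / (j + 1) * s)
      = 1 / ((j : ℝ) + 1) * ((j : ℝ) / (j + 1)) ^ j
          * (((j : ℝ) + 1) * s ^ j - j * s ^ (j + 1)) := by
        rw [mul_pow, pow_succ s]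
        generalize ((j : ℝ) / (j + 1)) ^ j = c
        generalize s ^ j = d
        field_simp
    _ ≤ _ := mul_le_of_le_one_right (by positivity) h

lemma pow_mul_one_sub_le_of_le_half {p : ℝ} (hp : 0 ≤ p) (hp2 : p ≤ 1 / 2) {j : ℕ}
    (hj : 1 ≤ j) : p ^ j * (1 - p) ≤ 1 / 2 ^ (1 + j) := by
  obtain ⟨k, rfl⟩ := Nat.exists_eq_add_of_le' hj
  calc p ^ (k + 1) * (1 - p) = p ^ k * (p * (1 - p)) := by ring
    _ ≤ (1 / 2) ^ k * (1 / 4) := by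
        refine mul_le_mul (pow_le_pow_left₀ hp hp2 k) ?_
          (mul_nonneg hp (by linarith)) (by positivity)
        nlinarith [sq_nonneg (p - 1 / 2)]
    _ = 1 / 2 ^ (1 + (k + 1)) := by
        rw [one_div_pow]
        ring

lemma pow_mul_one_sub_add_le {p : ℝ} (hp : 0 ≤ p) (hp1 : p ≤ 1) {j : ℕ} (hj : 1 ≤ j) :
    p ^ j * (1 - p) + (1 - p) ^ j * p ≤
      1 / ((j : ℝ) + 1) * ((j : ℝ) / (j + 1)) ^ j + 1 / 2 ^ (1 + j) := by
  have h1 : 0 ≤ 1 - p := by linarith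
  rcases le_total p (1 / 2) with h | h
  · have := pow_mul_one_sub_le_of_le_half hp h hj
    have := pow_mul_one_sub_le h1 hj
    rw [sub_sub_cancel] at this
    linarith
  · have := pow_mul_one_sub_le_of_le_half h1 (by linarith) hj
    rw [sub_sub_cancel] at this
    have := pow_mul_one_sub_le hp hj
    linarith

lemma abs_sub_pow_le_chord {a b x m : ℝ} (hab : a < b) (hx : x ∈ Set.Icc a b)
    (hm : m ∈ Set.Icc a b) (j : ℕ) :
    |x - m| ^ j ≤ (b - x) / (b - a) * (m - a) ^ j + (x - a) / (b - a) * (b - m) ^ j := by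
  obtain ⟨hxa, hxb⟩ := hx
  obtain ⟨hma, hmb⟩ := hm
  have hba : 0 < b - a := by linarith
  have hu : 0 ≤ (b - x) / (b - a) := div_nonneg (by linarith) hba.le
  have hv : 0 ≤ (x - a) / (b - a) := div_nonneg (by linarith) hba.le
  have huv : (b - x) / (b - a) + (x - a) / (b - a) = 1 := by field_simp; ring
  have hxm : x - m = (x - a) / (b - a) * (b - m) - (b - x) / (b - a) * (m - a) := by
    field_simp; ring
  have h1 := mul_nonneg hu (sub_nonneg.2 hma)
  have h2 := mul_nonneg hv (sub_nonneg.2 hmb)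
  have habs : |x - m| ≤ (b - x) / (b - a) * (m - a) + (x - a) / (b - a) * (b - m) := by
    rw [hxm, abs_le]
    constructor <;> linarith
  refine (pow_le_pow_left₀ (abs_nonneg _) habs j).trans ?_
  simpa using (convexOn_pow j).2 (sub_nonneg.2 hma) (sub_nonneg.2 hmb) hu hv huv

section

variable {a b : ℝ} {D : Measure ℝ} [IsProbabilityMeasure D]

lemma ae_mem_Icc_of_measure_eq_one (hD : D (Set.Icc a b) = 1) : ∀ᵐ x ∂D, x ∈ Set.Icc a b :=
  (prob_compl_eq_zero_iff measurableSet_Icc).2 hD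

lemma integrable_id_of_measure_Icc_eq_one (hD : D (Set.Icc a b) = 1) :
    Integrable (fun x : ℝ => x) D :=
  Integrable.of_mem_Icc a b aemeasurable_id (ae_mem_Icc_of_measure_eq_one hD)

lemma integral_mem_Icc_of_measure_eq_one (hD : D (Set.Icc a b) = 1) :
    ∫ x, x ∂D ∈ Set.Icc a b :=
  (convex_Icc a b).integral_mem isClosed_Icc (ae_mem_Icc_of_measure_eq_one hD)
    (integrable_id_of_measure_Icc_eq_one hD)

lemma abs_integral_sub_mean_pow_le (hab : a < b) (hD : D (Set.Icc a b) = 1) {j : ℕ}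
    (hj : 1 ≤ j) :
    |∫ x, (x - ∫ y, y ∂D) ^ j ∂D| ≤ (b - a) ^ j *
      (1 / ((j : ℝ) + 1) * ((j : ℝ) / (j + 1)) ^ j + 1 / 2 ^ (1 + j)) := by
  have hba : 0 < b - a := by linarith
  have hint := integrable_id_of_measure_Icc_eq_one hD
  have hm := integral_mem_Icc_of_measure_eq_one hD
  have hbx : Integrable (fun x => (b - x) / (b - a)) D :=
    ((integrable_const b).sub hint).div_const _
  have hxa : Integrable (fun x => (x - a) / (b - a)) D :=
    (hint.sub (integrable_const a)).div_const _
  have hbx' : ∫ x, (b - x) / (b - a) ∂D = (b - ∫ y, y ∂D) / (b - a) := by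
    rw [integral_div, integral_sub (integrable_const b) hint]
    simp
  have hxa' : ∫ x, (x - a) / (b - a) ∂D = ((∫ y, y ∂D) - a) / (b - a) := by
    rw [integral_div, integral_sub hint (integrable_const a)]
    simp
  generalize ∫ y, y ∂D = m at *
  have key := norm_integral_le_of_norm_le (μ := D) (f := fun x => (x - m) ^ j)
    ((hbx.mul_const ((m - a) ^ j)).add (hxa.mul_const ((b - m) ^ j)))
    ((ae_mem_Icc_of_measure_eq_one hD).mono fun x hx => by
      simpa [abs_pow] using abs_sub_pow_le_chord hab hx hm j)
  simp only [Pi.add_apply] at key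
  rw [integral_add (hbx.mul_const _) (hxa.mul_const _), integral_mul_const, integral_mul_const,
    hbx', hxa', Real.norm_eq_abs] at key
  obtain ⟨p, rfl⟩ : ∃ p, m = a + p * (b - a) := ⟨(m - a) / (b - a), by field_simp; ring⟩
  have hp : 0 ≤ p := nonneg_of_mul_nonneg_left (by linarith [hm.1]) hba
  have hp1 : p ≤ 1 := by
    by_contra! h
    nlinarith [hm.2]
  have h1 : a + p * (b - a) - a = p * (b - a) := by ring
  have h2 : b - (a + p * (b - a)) = (1 - p) * (b - a) := by ring
  rw [h1, h2, mul_div_cancel_right₀ _ hba.ne', mul_div_cancel_right₀ _ hba.ne', mul_pow,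
    mul_pow] at key
  calc _ ≤ _ := key
    _ = (b - a) ^ j * (p ^ j * (1 - p) + (1 - p) ^ j * p) := by ring
    _ ≤ _ := mul_le_mul_of_nonneg_left (pow_mul_one_sub_add_le hp hp1 hj) (by positivity)

end

/-- Upper central moment bound for measures supported on `[a,b]`. -/
theorem central_moment_upper_bound
    (a b : ℝ) (hab : a < b)
    (D D' : Measure ℝ) [IsProbabilityMeasure D] [IsProbabilityMeasure D']
    (hD : D (Set.Icc a b) = 1) (hD' : D' (Set.Icc a b) = 1) :
    ∀ j : ℕ, 1 ≤ j →
      (1 / |b - a| ^ j) * |cMom j D - cMom j D'| ≤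
        2 * ((1 / ((j : ℝ) + 1)) * ((j : ℝ) / ((j : ℝ) + 1)) ^ j
          + 1 / 2 ^ (1 + j)) := by
  intro j hj
  have hba : 0 < b - a := by linarith
  rw [abs_of_pos hba, one_div_mul_eq_div, div_le_iff₀ (pow_pos hba j)]
  unfold cMom
  split_ifs with h
  · subst h
    obtain ⟨h1, h2⟩ := integral_mem_Icc_of_measure_eq_one hD
    obtain ⟨h3, h4⟩ := integral_mem_Icc_of_measure_eq_one hD'
    norm_num
    rw [abs_le]
    constructor <;> linarith
  · have h1 := abs_integral_sub_mean_pow_le hab hD hj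
    have h2 := abs_integral_sub_mean_pow_le hab hD' hj
    refine (abs_sub _ _).trans ?_
    linarith
end

section
/- (Edmundson–Madansky inequality.) Let a < b be real numbers, let D be a probability measure on ℝ supported on [a,b] with mean μ = E_D[x], and let φ : ℝ → ℝ be convex on [a,b] and integrable with respect to D. Then E_D[φ(x)] ≤ ((b − μ)/(b − a)) · φ(a) + ((μ − a)/(b − a)) · φ(b). -/
open MeasureTheory

/-- Edmundson–Madansky inequality: for a probability measure `D` supported on
`[a,b]` with mean `μ` and a convex, `D`-integrable function `φ` on `[a,b]`,
`E_D[φ] ≤ ((b−μ)/(b−a))·φ(a) + ((μ−a)/(b−a))·φ(b)`. -/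
theorem edmundson_madansky
    (a b : ℝ) (hab : a < b)
    (D : Measure ℝ) [IsProbabilityMeasure D]
    (hsupp : D (Set.Icc a b) = 1)
    (φ : ℝ → ℝ) (hconv : ConvexOn ℝ (Set.Icc a b) φ)
    (hint : Integrable φ D) :
    (∫ x, φ x ∂D) ≤
      ((b - ∫ x, x ∂D) / (b - a)) * φ a + (((∫ x, x ∂D) - a) / (b - a)) * φ b := by
  have hba : 0 < b - a := sub_pos.2 hab
  have hmem : ∀ᵐ x ∂D, x ∈ Set.Icc a b := by
    rwa [← prob_compl_eq_zero_iff measurableSet_Icc] at hsupp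
  have hid : Integrable (fun x : ℝ => x) D :=
    Integrable.of_mem_Icc a b aemeasurable_id' hmem
  have hleft : Integrable (fun x => (b - x) / (b - a) * φ a) D :=
    (((integrable_const b).sub hid).div_const _).mul_const _
  have hright : Integrable (fun x => (x - a) / (b - a) * φ b) D :=
    ((hid.sub (integrable_const a)).div_const _).mul_const _
  calc
    ∫ x, φ x ∂D ≤ ∫ x, (b - x) / (b - a) * φ a + (x - a) / (b - a) * φ b ∂D := by
      refine integral_mono_ae hint (hleft.add hright) ?_
      filter_upwards [hmem] with x hx
      have h := hconv.2 (Set.left_mem_Icc.2 hab.le) (Set.right_mem_Icc.2 hab.le)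
        (div_nonneg (sub_nonneg.2 hx.2) hba.le) (div_nonneg (sub_nonneg.2 hx.1) hba.le)
        (by field_simp; ring)
      have hcomb : (b - x) / (b - a) * a + (x - a) / (b - a) * b = x := by
        field_simp
        ring
      simpa only [smul_eq_mul, hcomb] using h
    _ = (b - ∫ x, x ∂D) / (b - a) * φ a + ((∫ x, x ∂D) - a) / (b - a) * φ b := by
      rw [integral_add hleft hright, integral_mul_const, integral_mul_const,
        integral_div, integral_div, integral_sub (integrable_const b) hid,
        integral_sub hid (integrable_const a)]
      simp
end
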